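/- arXiv:2505.15927 — 11 statements merged into one kernel-verified Lean document; each statement's English description precedes it below -/
import Mathlib

section
/- (Realizable learning with CoT supervision, finite class.) Let H be a finite set of CoT hypotheses, h* ∈ H, ε ∈ (0,1), δ ∈ (0,1), and let I₀ > 0 be a real number such that D{x | h x = h* x} ≤ exp(−I₀) for every h ∈ Δ_D(ε;H,h*). Then the probability, over an i.i.d. sample (x₁,…,x_m) ∼ D^⊗m, of the event that there exists h ∈ H with L^E2E_D(h) > ε and h(xᵢ) = h*(xᵢ) for all i, is at most |H|·exp(−m·I₀). In particular, if m ≥ (log|H| + log(1/δ))/I₀, then with probability at least 1 − δ every CoT-consistent h ∈ H satisfies L^E2E_D(h) ≤ ε. -/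
open MeasureTheory ENNReal

/-- End-to-end risk of `h` relative to `hstar`: `D{x | (h x).1 ≠ (hstar x).1}`. -/
noncomputable def e2eRisk {X Y Z : Type*} [MeasurableSpace X]
    (D : Measure X) (hstar h : X → Y × Z) : ℝ :=
  (D {x | (h x).1 ≠ (hstar x).1}).toReal

theorem measureReal_pi_exists_forall_mem_le {α ι κ : Type*} [MeasurableSpace α]
    [Fintype κ] (D : Measure α) [IsProbabilityMeasure D] (s : Finset ι) (p : ι → Prop)
    (A : ι → Set α) {c : ℝ} (hc : 0 ≤ c) (hA : ∀ i ∈ s, p i → D.real (A i) ≤ c) :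
    (Measure.pi fun _ : κ => D).real {v | ∃ i ∈ s, p i ∧ ∀ j, v j ∈ A i}
      ≤ s.card * c ^ Fintype.card κ := by
  classical
  have hunion : {v : κ → α | ∃ i ∈ s, p i ∧ ∀ j, v j ∈ A i}
      = ⋃ i ∈ s.filter p, Set.univ.pi fun _ => A i := by
    ext v
    simp [Set.mem_pi, and_assoc]
  calc (Measure.pi fun _ : κ => D).real {v | ∃ i ∈ s, p i ∧ ∀ j, v j ∈ A i}
      ≤ ∑ i ∈ s.filter p, (Measure.pi fun _ : κ => D).real (Set.univ.pi fun _ => A i) := by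
        rw [hunion]
        exact measureReal_biUnion_finset_le _ _
    _ ≤ ∑ _i ∈ s.filter p, c ^ Fintype.card κ := by
        refine Finset.sum_le_sum fun i hi => ?_
        obtain ⟨his, hpi⟩ := Finset.mem_filter.mp hi
        rw [measureReal_def, Measure.pi_pi, Finset.prod_const, ENNReal.toReal_pow]
        exact pow_le_pow_left₀ measureReal_nonneg (hA i his hpi) _
    _ ≤ s.card * c ^ Fintype.card κ := by
        rw [Finset.sum_const, nsmul_eq_mul]
        gcongr
        exact Finset.filter_subset _ _

theorem mul_exp_neg_mul_le_of_log_add_log_div_le {n δ I t : ℝ} (hn : 0 < n) (hδ : 0 < δ)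
    (hI : 0 < I) (h : (Real.log n + Real.log (1 / δ)) / I ≤ t) :
    n * Real.exp (-(t * I)) ≤ δ := by
  rw [div_le_iff₀ hI, one_div, Real.log_inv] at h
  calc n * Real.exp (-(t * I)) = Real.exp (Real.log n + -(t * I)) := by
        rw [Real.exp_add, Real.exp_log hn]
    _ ≤ Real.exp (Real.log δ) := Real.exp_le_exp.mpr (by linarith)
    _ = δ := Real.exp_log hδ

theorem realizable_cot_learning_finite_class
    {X Y Z : Type*} [Fintype X] [Nonempty X] [Fintype Y] [Nonempty Y]
    [Fintype Z] [Nonempty Z] [MeasurableSpace X] [MeasurableSingletonClass X]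
    (D : Measure X) [IsProbabilityMeasure D]
    (H : Finset (X → Y × Z)) (hstar : X → Y × Z) (hmem : hstar ∈ H)
    (ε δ I₀ : ℝ) (hε : ε ∈ Set.Ioo (0:ℝ) 1) (hδ : δ ∈ Set.Ioo (0:ℝ) 1) (hI : 0 < I₀)
    (hinfo : ∀ h ∈ H, ε < e2eRisk D hstar h →
      (D {x | h x = hstar x}).toReal ≤ Real.exp (-I₀))
    (m : ℕ) :
    ((Measure.pi fun _ : Fin m => D)
        {v | ∃ h ∈ H, ε < e2eRisk D hstar h ∧ ∀ i, h (v i) = hstar (v i)}).toReal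
      ≤ (H.card : ℝ) * Real.exp (-(m * I₀))
    ∧ ((Real.log H.card + Real.log (1 / δ)) / I₀ ≤ (m : ℝ) →
        1 - δ ≤ ((Measure.pi fun _ : Fin m => D)
          {v | ∀ h ∈ H, (∀ i, h (v i) = hstar (v i)) →
            e2eRisk D hstar h ≤ ε}).toReal) := by
  have hbad : (Measure.pi fun _ : Fin m => D).real
      {v | ∃ h ∈ H, ε < e2eRisk D hstar h ∧ ∀ i, h (v i) = hstar (v i)}
        ≤ (H.card : ℝ) * Real.exp (-(m * I₀)) := by
    have hunion := measureReal_pi_exists_forall_mem_le (κ := Fin m) D H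
      (fun h => ε < e2eRisk D hstar h) (fun h => {x | h x = hstar x}) (Real.exp_nonneg (-I₀)) hinfo
    rwa [Fintype.card_fin, ← Real.exp_nat_mul, mul_neg] at hunion
  refine ⟨hbad, fun hm => ?_⟩
  have hδ_bound := mul_exp_neg_mul_le_of_log_add_log_div_le
    (Nat.cast_pos.mpr (Finset.card_pos.mpr ⟨hstar, hmem⟩)) hδ.1 hI hm
  have hcompl : {v : Fin m → X | ∀ h ∈ H, (∀ i, h (v i) = hstar (v i)) → e2eRisk D hstar h ≤ ε}
      = {v | ∃ h ∈ H, ε < e2eRisk D hstar h ∧ ∀ i, h (v i) = hstar (v i)}ᶜ := by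
    ext v
    simp only [Set.mem_compl_iff, Set.mem_ofPred_eq]
    grind
  rw [← measureReal_def, hcompl, probReal_compl_eq_one_sub (Set.toFinite _).measurableSet]
  linarith
end

section
/- (Total variation of fully supervised product laws.) For CoT hypotheses h₁, h₂ : X → Y × Z, let P_{h_j} be the pushforward of D under x ↦ (x, h_j x), a probability measure on X × (Y × Z), and let P_{h_j}^⊗m be its m-fold product on Fin m → X × (Y × Z). Then the total variation distance satisfies sup over sets A of |P_{h₁}^⊗m(A) − P_{h₂}^⊗m(A)| = 1 − (D{x | h₁ x = h₂ x})^m. -/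
open MeasureTheory ENNReal

/-- If `F` is injective and `F x = G y` forces `x = y`, the laws of `F` and `G` are at total
variation distance `μ {x | F x ≠ G x}`. -/
theorem iSup_abs_map_sub_map_eq {S T : Type*} [Finite S] [Finite T]
    [MeasurableSpace S] [MeasurableSingletonClass S]
    [MeasurableSpace T] [MeasurableSingletonClass T]
    (μ : Measure S) [IsProbabilityMeasure μ] (F G : S → T)
    (hF : Function.Injective F) (hFG : ∀ x y, F x = G y → x = y) :
    (⨆ A : Set T, |(μ.map F A).toReal - (μ.map G A).toReal|)
      = 1 - (μ {x | F x = G x}).toReal := by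
  have hmap : ∀ (f : S → T) (A : Set T), (μ.map f A).toReal = μ.real (f ⁻¹' A) := fun f A => by
    rw [Measure.map_apply (measurable_of_finite f) A.toFinite.measurableSet, measureReal_def]
  simp only [hmap, ← measureReal_def]
  rw [← probReal_compl_eq_one_sub (Set.toFinite _).measurableSet]
  set E : Set S := {x | F x = G x} with hE
  have hle : ∀ f g : S → T, (∀ x ∈ E, f x = g x) → ∀ A : Set T,
      μ.real (f ⁻¹' A) ≤ μ.real Eᶜ + μ.real (g ⁻¹' A) := fun f g hfg A => by
    refine (measureReal_mono fun x hx => ?_).trans (measureReal_union_le _ _)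
    by_cases hxE : x ∈ E
    · exact Or.inr (by simpa [← hfg x hxE] using hx)
    · exact Or.inl hxE
  have hbound : ∀ A : Set T, |μ.real (F ⁻¹' A) - μ.real (G ⁻¹' A)| ≤ μ.real Eᶜ := fun A =>
    abs_sub_le_iff.2 ⟨sub_le_iff_le_add.2 (hle F G (fun _ hx => hx) A),
      sub_le_iff_le_add.2 (hle G F (fun _ hx => Eq.symm hx) A)⟩
  refine le_antisymm (ciSup_le hbound) ?_
  have hempty : G ⁻¹' (F '' Eᶜ) = ∅ := by
    refine Set.eq_empty_of_forall_notMem ?_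
    rintro y ⟨x, hx, hxy⟩
    obtain rfl := hFG x y hxy
    exact hx hxy
  refine le_ciSup_of_le ⟨_, Set.forall_mem_range.2 hbound⟩ (F '' Eᶜ) ?_
  rw [hempty, hF.preimage_image, measureReal_empty, sub_zero]
  exact le_abs_self _

theorem total_variation_of_fully_supervised_product_laws
    {X Y Z : Type*} [Fintype X] [Nonempty X] [Fintype Y] [Nonempty Y]
    [Fintype Z] [Nonempty Z]
    [MeasurableSpace X] [MeasurableSingletonClass X]
    [MeasurableSpace Y] [MeasurableSingletonClass Y]
    [MeasurableSpace Z] [MeasurableSingletonClass Z]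
    (D : Measure X) [IsProbabilityMeasure D]
    (h₁ h₂ : X → Y × Z) (m : ℕ) :
    (⨆ A : Set (Fin m → X × (Y × Z)),
        |((Measure.pi fun _ : Fin m => Measure.map (fun x => (x, h₁ x)) D) A).toReal
          - ((Measure.pi fun _ : Fin m => Measure.map (fun x => (x, h₂ x)) D) A).toReal|)
      = 1 - (D {x | h₁ x = h₂ x}).toReal ^ m := by
  have hpi : ∀ h : X → Y × Z, (Measure.pi fun _ : Fin m => D.map fun x => (x, h x))
      = (Measure.pi fun _ : Fin m => D).map fun x i => (x i, h (x i)) := fun h => by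
    have : IsProbabilityMeasure (D.map fun x => (x, h x)) :=
      Measure.isProbabilityMeasure_map (measurable_of_finite _).aemeasurable
    exact (Measure.pi_map_pi fun _ => (measurable_of_finite _).aemeasurable).symm
  have hfst : ∀ (f g : X → Y × Z) (x y : Fin m → X),
      (fun i => (x i, f (x i))) = (fun i => (y i, g (y i))) → x = y :=
    fun f g x y hxy => funext fun i => congrArg Prod.fst (congrFun hxy i)
  have hset : {x : Fin m → X | (fun i => (x i, h₁ (x i))) = fun i => (x i, h₂ (x i))}
      = Set.univ.pi fun _ => {x | h₁ x = h₂ x} := by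
    ext x
    simp [funext_iff]
  rw [hpi h₁, hpi h₂, iSup_abs_map_sub_map_eq _ _ _ (hfst h₁ h₁) (hfst h₁ h₂), hset,
    Measure.pi_pi]
  simp
end

section
/- (Two-point expected-error lower bound for any learning algorithm.) Let A : (Fin m → X × (Y × Z)) → (X → Y) be any function (a learning algorithm from CoT-annotated samples to end-to-end predictors). For a CoT hypothesis h, let S_h(x⃗) := (i ↦ (x⃗ i, h (x⃗ i))) denote the sample labeled by h, and for predictors f, g : X → Y write d(f,g) := D{x | f x ≠ g x}. Then for any two CoT hypotheses h₁, h₂ : X → Y × Z, max over j ∈ {1,2} of E_{x⃗ ∼ D^⊗m}[ d(A(S_{h_j}(x⃗)), x ↦ (h_j x).1) ] ≥ (1/2) · D{x | (h₁ x).1 ≠ (h₂ x).1} · (D{x | h₁ x = h₂ x})^m. -/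
open MeasureTheory ENNReal

/-- Triangle inequality for the disagreement probability: the errors of `f` against `g₁` and `g₂`
add up to at least the disagreement of `g₁` and `g₂`. -/
theorem measureReal_ne_le_add {X Y : Type*} [MeasurableSpace X] (D : Measure X)
    [IsFiniteMeasure D] (f g₁ g₂ : X → Y) :
    D.real {x | g₁ x ≠ g₂ x} ≤ D.real {x | f x ≠ g₁ x} + D.real {x | f x ≠ g₂ x} := by
  refine (measureReal_mono ?_).trans (measureReal_union_le _ _)
  intro x hx
  by_contra hc
  simp only [Set.mem_union, Set.mem_ofPred_eq, not_or, not_not] at hc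
  exact hx (hc.1.symm.trans hc.2)

theorem two_point_expected_error_lower_bound
    {X Y Z : Type*} [Fintype X] [Nonempty X] [Fintype Y] [Nonempty Y]
    [Fintype Z] [Nonempty Z] [MeasurableSpace X] [MeasurableSingletonClass X]
    (D : Measure X) [IsProbabilityMeasure D]
    (m : ℕ) (A : (Fin m → X × (Y × Z)) → (X → Y))
    (h₁ h₂ : X → Y × Z) :
    (1 / 2) * (D {x | (h₁ x).1 ≠ (h₂ x).1}).toReal
        * (D {x | h₁ x = h₂ x}).toReal ^ m
      ≤ max
        (∫ v, (D {x | A (fun i => (v i, h₁ (v i))) x ≠ (h₁ x).1}).toReal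
          ∂(Measure.pi fun _ : Fin m => D))
        (∫ v, (D {x | A (fun i => (v i, h₂ (v i))) x ≠ (h₂ x).1}).toReal
          ∂(Measure.pi fun _ : Fin m => D)) := by
  set P : Measure (Fin m → X) := Measure.pi fun _ : Fin m => D
  set E : Set (Fin m → X) := Set.univ.pi fun _ => {x | h₁ x = h₂ x}
  set f₁ : (Fin m → X) → ℝ :=
    fun v => (D {x | A (fun i => (v i, h₁ (v i))) x ≠ (h₁ x).1}).toReal
  set f₂ : (Fin m → X) → ℝ :=
    fun v => (D {x | A (fun i => (v i, h₂ (v i))) x ≠ (h₂ x).1}).toReal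
  set δ : ℝ := (D {x | (h₁ x).1 ≠ (h₂ x).1}).toReal
  have hE : P.real E = (D {x | h₁ x = h₂ x}).toReal ^ m := by
    simp [P, E, Measure.real, Measure.pi_pi]
  have hle : ∀ v, E.indicator (fun _ => δ) v ≤ f₁ v + f₂ v := by
    intro v
    by_cases hv : v ∈ E
    · have hs : (fun i => (v i, h₁ (v i))) = fun i => (v i, h₂ (v i)) :=
        funext fun i => Prod.ext rfl (hv i (Set.mem_univ i))
      rw [Set.indicator_of_mem hv]
      simp only [f₁, f₂, hs]
      exact measureReal_ne_le_add D _ _ _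
    · rw [Set.indicator_of_notMem hv]
      exact add_nonneg toReal_nonneg toReal_nonneg
  have hsum : P.real E * δ ≤ ∫ v, f₁ v ∂P + ∫ v, f₂ v ∂P := by
    rw [← integral_add Integrable.of_finite Integrable.of_finite, ← smul_eq_mul,
      ← integral_indicator_const δ E.toFinite.measurableSet]
    exact integral_mono Integrable.of_finite Integrable.of_finite hle
  rw [hE] at hsum
  have hmax₁ := le_max_left (∫ v, f₁ v ∂P) (∫ v, f₂ v ∂P)
  have hmax₂ := le_max_right (∫ v, f₁ v ∂P) (∫ v, f₂ v ∂P)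
  linarith
end

section
/- (KL divergence of noisy CoT observations is controlled by channel capacity times disagreement.) Let W be a nonempty finite type, Q : W → (probability measure on W) a noisy channel, and C ∈ [0,∞] such that KL(Q a ‖ Q b) ≤ C for all a, b ∈ W. For a function h : X → W, let P_h be the probability measure on X × W given by P_h{(x,w)} = D{x} · (Q (h x)){w} (the law of (x,w) with x ∼ D and w ∼ Q(h x)). Then for any h₁, h₂ : X → W, KL(P_{h₁} ‖ P_{h₂}) ≤ C · D{x | h₁ x ≠ h₂ x} (with the product taken in [0,∞]). -/
open MeasureTheory ENNReal

/-- Kullback–Leibler divergence between probability measures on a finite type,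
valued in `[0,∞]`: `∞` if `μ` is not absolutely continuous w.r.t. `ν`, otherwise
the sum over atoms of `μ{w}·log(μ{w}/ν{w})`. -/
noncomputable def finKL {W : Type*} [Fintype W] [MeasurableSpace W]
    (μ ν : Measure W) : ℝ≥0∞ :=
  if ∀ w : W, ν {w} = 0 → μ {w} = 0 then
    ENNReal.ofReal
      (∑ w : W, (μ {w}).toReal * Real.log ((μ {w}).toReal / (ν {w}).toReal))
  else ⊤

/-- Law of `(x, w)` where `x ∼ D` and `w ∼ Q (h x)`:
`P_h{(x,w)} = D{x} · (Q (h x)){w}`. -/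
noncomputable def noisyLaw {X W : Type*} [Fintype X] [MeasurableSpace X]
    [MeasurableSpace W]
    (D : Measure X) (Q : W → Measure W) (h : X → W) : Measure (X × W) :=
  ∑ x : X, D {x} • Measure.map (Prod.mk x) (Q (h x))

theorem noisyLaw_singleton
    {X W : Type*} [Fintype X] [MeasurableSpace X] [MeasurableSingletonClass X]
    [MeasurableSpace W] [MeasurableSingletonClass W]
    (D : Measure X) (Q : W → Measure W) (h : X → W) (x : X) (w : W) :
    noisyLaw D Q h {(x, w)} = D {x} * Q (h x) {w} := by
  classical
  have key : ∀ y : X, D {y} * (Measure.map (Prod.mk y) (Q (h y))) {(x, w)} =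
      if y = x then D {x} * Q (h x) {w} else 0 := by
    intro y
    rw [Measure.map_apply measurable_prodMk_left (measurableSet_singleton _)]
    split_ifs with hy
    · subst hy
      congr 2
      ext v
      simp
    · have : Prod.mk y ⁻¹' {(x, w)} = (∅ : Set W) := by
        ext v
        simp [hy]
      simp [this]
  simp [noisyLaw, Measure.finsetSum_apply, key]

theorem finKL_self {W : Type*} [Fintype W] [MeasurableSpace W] (μ : Measure W) :
    finKL μ μ = 0 := by
  simp [finKL]

/-- The conditional form of the divergence of two noisy laws with a common input law bounds it
from above. -/
theorem finKL_noisyLaw_le_sum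
    {X W : Type*} [Fintype X] [Fintype W]
    [MeasurableSpace X] [MeasurableSingletonClass X]
    [MeasurableSpace W] [MeasurableSingletonClass W]
    (D : Measure X) [IsFiniteMeasure D] (Q : W → Measure W) (h₁ h₂ : X → W) :
    finKL (noisyLaw D Q h₁) (noisyLaw D Q h₂) ≤
      ∑ x, D {x} * finKL (Q (h₁ x)) (Q (h₂ x)) := by
  by_cases hac : ∀ z : X × W, noisyLaw D Q h₂ {z} = 0 → noisyLaw D Q h₁ {z} = 0
  · rw [finKL, if_pos hac, Fintype.sum_prod_type]
    refine (Finset.le_sum_of_subadditive ENNReal.ofReal ENNReal.ofReal_zero.le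
      (fun _ _ => ENNReal.ofReal_add_le) _ _).trans (Finset.sum_le_sum fun x _ => ?_)
    simp only [noisyLaw_singleton, ENNReal.toReal_mul]
    by_cases hx : D {x} = 0
    · simp [hx]
    have hacx : ∀ w, Q (h₂ x) {w} = 0 → Q (h₁ x) {w} = 0 := by
      intro w hw
      simpa [noisyLaw_singleton, hw, hx] using hac (x, w)
    have hd : (D {x}).toReal ≠ 0 := ENNReal.toReal_ne_zero.2 ⟨hx, measure_ne_top _ _⟩
    rw [finKL, if_pos hacx]
    conv_rhs => rw [← ENNReal.ofReal_toReal (measure_ne_top D {x})]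
    rw [← ENNReal.ofReal_mul ENNReal.toReal_nonneg, Finset.mul_sum]
    simp only [mul_div_mul_left _ _ hd, mul_assoc, le_refl]
  · push Not at hac
    obtain ⟨⟨x, w⟩, h2, h1⟩ := hac
    rw [noisyLaw_singleton] at h1 h2
    have hx : D {x} ≠ 0 := left_ne_zero_of_mul h1
    have hq : ¬ ∀ w, Q (h₂ x) {w} = 0 → Q (h₁ x) {w} = 0 := fun H =>
      right_ne_zero_of_mul h1 (H w ((mul_eq_zero.1 h2).resolve_left hx))
    have htop : D {x} * finKL (Q (h₁ x)) (Q (h₂ x)) = ⊤ := by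
      rw [finKL, if_neg hq, ENNReal.mul_top hx]
    rw [ENNReal.sum_eq_top.2 ⟨x, Finset.mem_univ x, htop⟩]
    exact le_top

theorem kl_noisy_cot_le_capacity_mul_disagreement
    {X W : Type*} [Fintype X] [Nonempty X] [Fintype W] [Nonempty W]
    [MeasurableSpace X] [MeasurableSingletonClass X]
    [MeasurableSpace W] [MeasurableSingletonClass W]
    (D : Measure X) [IsProbabilityMeasure D]
    (Q : W → Measure W) (hQ : ∀ w, IsProbabilityMeasure (Q w))
    (C : ℝ≥0∞) (hC : ∀ a b : W, finKL (Q a) (Q b) ≤ C)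
    (h₁ h₂ : X → W) :
    finKL (noisyLaw D Q h₁) (noisyLaw D Q h₂) ≤ C * D {x | h₁ x ≠ h₂ x} := by
  classical
  have hD : D {x | h₁ x ≠ h₂ x} = ∑ x with h₁ x ≠ h₂ x, D {x} := by
    rw [sum_measure_singleton]
    simp
  rw [hD, Finset.mul_sum, Finset.sum_filter]
  refine (finKL_noisyLaw_le_sum D Q h₁ h₂).trans (Finset.sum_le_sum fun x _ => ?_)
  split_ifs with hx
  · rw [mul_comm]
    gcongr
    exact hC _ _
  · rw [not_not.1 hx, finKL_self, mul_zero]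
end

section
/- (KL divergence across a symmetric channel.) Let W be a finite type with N := |W| ≥ 2, let e ∈ (0,1], and for w ∈ W define the probability measure Q_w := (1 − e)·δ_w + e·Unif(W), where δ_w is the point mass at w and Unif(W) the uniform measure. Then for any w₁ ≠ w₂ in W, KL(Q_{w₁} ‖ Q_{w₂}) = (1 − e)·log(1 + N(1 − e)/e). -/
open MeasureTheory ENNReal

/-- The symmetric channel output distribution: `(1−e)·δ_w + e·Unif(W)`. -/
noncomputable def symChannel {W : Type*} [Fintype W] [MeasurableSpace W]
    (e : ℝ) (w : W) : Measure W :=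
  ENNReal.ofReal (1 - e) • Measure.dirac w
    + ENNReal.ofReal e • ((Fintype.card W : ℝ≥0∞)⁻¹ • Measure.count)

open Classical in
/-- The mass that the symmetric channel puts on an atom. -/
theorem symChannel_singleton {W : Type*} [Fintype W] [MeasurableSpace W]
    [MeasurableSingletonClass W] [Nonempty W] {e : ℝ} (he0 : 0 ≤ e) (he1 : e ≤ 1) (w x : W) :
    symChannel e w {x}
      = ENNReal.ofReal ((if x = w then 1 - e else 0) + e / (Fintype.card W : ℝ)) := by
  have hN : (0 : ℝ) < Fintype.card W := by exact_mod_cast Fintype.card_pos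
  have hdiv : ENNReal.ofReal (e / (Fintype.card W : ℝ))
      = ENNReal.ofReal e * (Fintype.card W : ℝ≥0∞)⁻¹ := by
    rw [ENNReal.ofReal_div_of_pos hN, ENNReal.ofReal_natCast, div_eq_mul_inv]
  rw [ENNReal.ofReal_add (by split_ifs <;> linarith) (by positivity), hdiv]
  by_cases h : x = w
  · simp [symChannel, h]
  · simp [symChannel, h, Ne.symm h]

theorem kl_symmetric_channel
    {W : Type*} [Fintype W] [MeasurableSpace W] [MeasurableSingletonClass W]
    (hN : 2 ≤ Fintype.card W)
    (e : ℝ) (he0 : 0 < e) (he1 : e ≤ 1)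
    (w₁ w₂ : W) (hw : w₁ ≠ w₂) :
    finKL (symChannel e w₁) (symChannel e w₂)
      = ENNReal.ofReal
          ((1 - e) * Real.log (1 + (Fintype.card W : ℝ) * (1 - e) / e)) := by
  classical
  have : Nonempty W := ⟨w₁⟩
  have hNpos : (0 : ℝ) < Fintype.card W := by exact_mod_cast Fintype.card_pos
  have hu : 0 < e / (Fintype.card W : ℝ) := by positivity
  have hpos : ∀ w x : W, 0 < (if x = w then 1 - e else 0) + e / (Fintype.card W : ℝ) := by
    intro w x
    split_ifs <;> linarith
  have hac : ∀ w : W, symChannel e w₂ {w} = 0 → symChannel e w₁ {w} = 0 := by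
    intro w h
    rw [symChannel_singleton he0.le he1, ENNReal.ofReal_eq_zero] at h
    exact absurd h (hpos w₂ w).not_ge
  have hreal : ∀ w x : W, (symChannel e w {x}).toReal
      = (if x = w then 1 - e else 0) + e / (Fintype.card W : ℝ) := by
    intro w x
    rw [symChannel_singleton he0.le he1, ENNReal.toReal_ofReal (hpos w x).le]
  have hratio : 1 + (Fintype.card W : ℝ) * (1 - e) / e
      = (1 - e + e / (Fintype.card W : ℝ)) / (e / (Fintype.card W : ℝ)) := by
    field_simp
    ring
  rw [finKL, if_pos hac, hratio]
  congr 1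
  simp only [hreal]
  rw [Fintype.sum_eq_add w₁ w₂ hw]
  · simp only [if_true, if_neg hw, if_neg hw.symm, zero_add]
    rw [← inv_div (1 - e + e / (Fintype.card W : ℝ)), Real.log_inv]
    ring
  · rintro x ⟨h₁, h₂⟩
    simp [h₁, h₂, div_self hu.ne']
end

section
/- (Learning with mixed end-to-end and CoT supervision, finite class.) Let H be a finite set of CoT hypotheses, h* ∈ H, ε ∈ (0,1), and let I₀ > 0 be a real number such that D{x | h x = h* x} ≤ exp(−I₀) for every h ∈ Δ_D(ε;H,h*). Draw independently an i.i.d. sample (x₁,…,x_{m₁}) ∼ D^⊗m₁ (end-to-end supervised) and an i.i.d. sample (x'₁,…,x'_{m₂}) ∼ D^⊗m₂ (CoT supervised). Then the probability that there exists h ∈ H with L^E2E_D(h) > ε such that (h xᵢ).1 = (h* xᵢ).1 for all i ≤ m₁ and h(x'ⱼ) = h*(x'ⱼ) for all j ≤ m₂ is at most |H|·exp(−m₁·ε − m₂·I₀). In particular, this probability is at most δ whenever m₁·ε + m₂·I₀ ≥ log|H| + log(1/δ). -/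
open MeasureTheory ENNReal

/-- Union bound: the probability that, for some `h ∈ S`, all `m₁` points of one i.i.d. sample lie in
`A h` and all `m₂` points of an independent one lie in `B h`. -/
theorem measureReal_exists_forall_mem_le {ι X : Type*} [MeasurableSpace X]
    (D : Measure X) [IsProbabilityMeasure D] (S : Finset ι) (A B : ι → Set X) (m₁ m₂ : ℕ)
    {a b : ℝ} (hA : ∀ h ∈ S, D.real (A h) ≤ a) (hB : ∀ h ∈ S, D.real (B h) ≤ b) :
    ((Measure.pi fun _ : Fin m₁ => D).prod (Measure.pi fun _ : Fin m₂ => D)).real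
      {p | ∃ h ∈ S, (∀ i, p.1 i ∈ A h) ∧ ∀ j, p.2 j ∈ B h} ≤ (S.card : ℝ) * (a ^ m₁ * b ^ m₂) := by
  have hset : {p : (Fin m₁ → X) × (Fin m₂ → X) |
      ∃ h ∈ S, (∀ i, p.1 i ∈ A h) ∧ ∀ j, p.2 j ∈ B h} =
      ⋃ h ∈ S, (Set.univ.pi fun _ => A h) ×ˢ (Set.univ.pi fun _ => B h) := by
    ext p
    simp [and_left_comm]
  rw [hset, ← nsmul_eq_mul]
  refine (measureReal_biUnion_finset_le _ _).trans (Finset.sum_le_card_nsmul _ _ _ fun h hh => ?_)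
  rw [measureReal_prod_prod]
  simp only [measureReal_def, Measure.pi_pi, Finset.prod_const, Finset.card_univ, Fintype.card_fin,
    ENNReal.toReal_pow]
  have ha := hA h hh
  have hb := hB h hh
  rw [measureReal_def] at ha hb
  have : 0 ≤ a := ENNReal.toReal_nonneg.trans ha
  gcongr

/-- A hypothesis of end-to-end risk above `ε` agrees with the reference on the output with
probability at most `exp (-ε)`. -/
theorem measureReal_fst_eq_le_exp_neg {X Y Z : Type*} [Finite X] [MeasurableSpace X]
    [MeasurableSingletonClass X] (D : Measure X) [IsProbabilityMeasure D]
    (hstar h : X → Y × Z) {ε : ℝ} (hε : ε < e2eRisk D hstar h) :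
    D.real {x | (h x).1 = (hstar x).1} ≤ Real.exp (-ε) := by
  have hc := probReal_compl_eq_one_sub (μ := D)
    (Set.toFinite {x | (h x).1 = (hstar x).1}).measurableSet
  have hr : e2eRisk D hstar h = D.real {x | (h x).1 = (hstar x).1}ᶜ := rfl
  linarith [Real.add_one_le_exp (-ε)]

theorem mixed_supervision_learning_finite_class
    {X Y Z : Type*} [Fintype X] [Nonempty X] [Fintype Y] [Nonempty Y]
    [Fintype Z] [Nonempty Z] [MeasurableSpace X] [MeasurableSingletonClass X]
    (D : Measure X) [IsProbabilityMeasure D]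
    (H : Finset (X → Y × Z)) (hstar : X → Y × Z) (hmem : hstar ∈ H)
    (ε I₀ : ℝ) (hε : ε ∈ Set.Ioo (0:ℝ) 1) (hI : 0 < I₀)
    (hinfo : ∀ h ∈ H, ε < e2eRisk D hstar h →
      (D {x | h x = hstar x}).toReal ≤ Real.exp (-I₀))
    (m₁ m₂ : ℕ) :
    (((Measure.pi fun _ : Fin m₁ => D).prod (Measure.pi fun _ : Fin m₂ => D))
        {p | ∃ h ∈ H, ε < e2eRisk D hstar h
          ∧ (∀ i, (h (p.1 i)).1 = (hstar (p.1 i)).1)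
          ∧ ∀ j, h (p.2 j) = hstar (p.2 j)}).toReal
      ≤ (H.card : ℝ) * Real.exp (-((m₁ : ℝ) * ε) - (m₂ : ℝ) * I₀)
    ∧ (∀ δ : ℝ, 0 < δ →
        Real.log H.card + Real.log (1 / δ) ≤ (m₁ : ℝ) * ε + (m₂ : ℝ) * I₀ →
        (((Measure.pi fun _ : Fin m₁ => D).prod (Measure.pi fun _ : Fin m₂ => D))
          {p | ∃ h ∈ H, ε < e2eRisk D hstar h
            ∧ (∀ i, (h (p.1 i)).1 = (hstar (p.1 i)).1)
            ∧ ∀ j, h (p.2 j) = hstar (p.2 j)}).toReal ≤ δ) := by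
  classical
  have key : (((Measure.pi fun _ : Fin m₁ => D).prod (Measure.pi fun _ : Fin m₂ => D))
        {p | ∃ h ∈ H, ε < e2eRisk D hstar h
          ∧ (∀ i, (h (p.1 i)).1 = (hstar (p.1 i)).1)
          ∧ ∀ j, h (p.2 j) = hstar (p.2 j)}).toReal
      ≤ (H.card : ℝ) * Real.exp (-((m₁ : ℝ) * ε) - (m₂ : ℝ) * I₀) := by
    have hbound := measureReal_exists_forall_mem_le D (H.filter fun h => ε < e2eRisk D hstar h)
      (fun h => {x | (h x).1 = (hstar x).1}) (fun h => {x | h x = hstar x}) m₁ m₂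
      (fun h hh => measureReal_fst_eq_le_exp_neg D hstar h (Finset.mem_filter.1 hh).2)
      (fun h hh => hinfo h (Finset.mem_filter.1 hh).1 (Finset.mem_filter.1 hh).2)
    have hexp : Real.exp (-ε) ^ m₁ * Real.exp (-I₀) ^ m₂ =
        Real.exp (-((m₁ : ℝ) * ε) - (m₂ : ℝ) * I₀) := by
      rw [← Real.exp_nat_mul, ← Real.exp_nat_mul, ← Real.exp_add]
      ring_nf
    rw [hexp] at hbound
    simp only [Finset.mem_filter, Set.mem_ofPred_eq, and_assoc] at hbound
    refine hbound.trans ?_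
    gcongr
    exact Finset.filter_subset _ _
  refine ⟨key, fun δ hδ hm => key.trans ?_⟩
  have hcard : (0 : ℝ) < H.card := by exact_mod_cast Finset.card_pos.2 ⟨hstar, hmem⟩
  rw [one_div, Real.log_inv] at hm
  calc (H.card : ℝ) * Real.exp (-((m₁ : ℝ) * ε) - (m₂ : ℝ) * I₀)
      ≤ H.card * Real.exp (Real.log δ - Real.log H.card) := by
        refine mul_le_mul_of_nonneg_left (Real.exp_le_exp.2 ?_) hcard.le
        linarith
    _ = δ := by
        rw [Real.exp_sub, Real.exp_log hδ, Real.exp_log hcard]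
        field_simp
end

section
/- (Transfer learning with CoT supervision.) Let D_tr and D_test be probability measures on X, H a finite set of CoT hypotheses, h* ∈ H, ε ∈ (0,1), δ ∈ (0,1), and let I₀ > 0 be a real number such that D_tr{x | h x = h* x} ≤ exp(−I₀) for every h ∈ H with D_test{x | (h x).1 ≠ (h* x).1} > ε. Then the probability, over an i.i.d. sample (x₁,…,x_m) ∼ D_tr^⊗m, that there exists h ∈ H with D_test{x | (h x).1 ≠ (h* x).1} > ε and h(xᵢ) = h*(xᵢ) for all i, is at most |H|·exp(−m·I₀); in particular it is at most δ whenever m ≥ (log|H| + log(1/δ))/I₀. -/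
open MeasureTheory ENNReal

/-- The probability that an i.i.d. sample of size `m` lies entirely in a set of probability at most
`p` is at most `p ^ m`. -/
theorem pi_real_forall_mem_le_pow {X : Type*} [MeasurableSpace X] (μ : Measure X)
    [IsProbabilityMeasure μ] (s : Set X) {p : ℝ} (hs : μ.real s ≤ p) (m : ℕ) :
    (Measure.pi fun _ : Fin m => μ).real {v | ∀ i, v i ∈ s} ≤ p ^ m := by
  have h : {v : Fin m → X | ∀ i, v i ∈ s} = Set.univ.pi fun _ => s := by
    ext v
    simp
  rw [h, measureReal_def, Measure.pi_pi, Finset.prod_const, Finset.card_univ, Fintype.card_fin,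
    ENNReal.toReal_pow]
  exact pow_le_pow_left₀ ENNReal.toReal_nonneg hs m

/-- Union bound: if each bad index `h ∈ H` has a set `A h` of probability at most `p`, then an
i.i.d. sample lies entirely in some bad `A h` with probability at most `|H| * p ^ m`. -/
theorem pi_real_exists_forall_mem_le {X ι : Type*} [MeasurableSpace X] (μ : Measure X)
    [IsProbabilityMeasure μ] (H : Finset ι) (bad : ι → Prop) (A : ι → Set X) {p : ℝ}
    (hp : 0 ≤ p) (hA : ∀ h ∈ H, bad h → μ.real (A h) ≤ p) (m : ℕ) :
    (Measure.pi fun _ : Fin m => μ).real {v | ∃ h ∈ H, bad h ∧ ∀ i, v i ∈ A h}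
      ≤ H.card * p ^ m := by
  have hU : {v : Fin m → X | ∃ h ∈ H, bad h ∧ ∀ i, v i ∈ A h}
      = ⋃ h ∈ H, {v | bad h ∧ ∀ i, v i ∈ A h} := by
    ext v
    simp only [Set.mem_iUnion, Set.mem_ofPred_eq, exists_prop]
  rw [hU, ← nsmul_eq_mul]
  refine (measureReal_biUnion_finset_le _ _).trans (Finset.sum_le_card_nsmul _ _ _ fun h hh => ?_)
  by_cases hb : bad h
  · simpa only [hb, true_and] using pi_real_forall_mem_le_pow μ (A h) (hA h hh hb) m
  · simpa [hb] using pow_nonneg hp m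

/-- The sample-size condition under which `N * exp (-m I)` drops below `δ`. -/
theorem mul_exp_neg_le_of_log_add_log_div_le {N δ I m : ℝ} (hN : 0 < N) (hδ : 0 < δ) (hI : 0 < I)
    (h : (Real.log N + Real.log (1 / δ)) / I ≤ m) : N * Real.exp (-(m * I)) ≤ δ := by
  rw [div_le_iff₀ hI, one_div, Real.log_inv] at h
  calc N * Real.exp (-(m * I)) = Real.exp (Real.log N + -(m * I)) := by
        rw [Real.exp_add, Real.exp_log hN]
    _ ≤ Real.exp (Real.log δ) := Real.exp_le_exp.2 (by linarith)
    _ = δ := Real.exp_log hδ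

theorem transfer_learning_with_cot_supervision
    {X Y Z : Type*} [Fintype X] [Nonempty X] [Fintype Y] [Nonempty Y]
    [Fintype Z] [Nonempty Z] [MeasurableSpace X] [MeasurableSingletonClass X]
    (Dtr Dtest : Measure X) [IsProbabilityMeasure Dtr] [IsProbabilityMeasure Dtest]
    (H : Finset (X → Y × Z)) (hstar : X → Y × Z) (hmem : hstar ∈ H)
    (ε δ I₀ : ℝ) (hε : ε ∈ Set.Ioo (0:ℝ) 1) (hδ : δ ∈ Set.Ioo (0:ℝ) 1) (hI : 0 < I₀)
    (hinfo : ∀ h ∈ H, ε < (Dtest {x | (h x).1 ≠ (hstar x).1}).toReal →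
      (Dtr {x | h x = hstar x}).toReal ≤ Real.exp (-I₀))
    (m : ℕ) :
    ((Measure.pi fun _ : Fin m => Dtr)
        {v | ∃ h ∈ H, ε < (Dtest {x | (h x).1 ≠ (hstar x).1}).toReal
          ∧ ∀ i, h (v i) = hstar (v i)}).toReal
      ≤ (H.card : ℝ) * Real.exp (-(m * I₀))
    ∧ ((Real.log H.card + Real.log (1 / δ)) / I₀ ≤ (m : ℝ) →
        ((Measure.pi fun _ : Fin m => Dtr)
          {v | ∃ h ∈ H, ε < (Dtest {x | (h x).1 ≠ (hstar x).1}).toReal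
            ∧ ∀ i, h (v i) = hstar (v i)}).toReal ≤ δ) := by
  have hbound := pi_real_exists_forall_mem_le Dtr H
    (fun h => ε < (Dtest {x | (h x).1 ≠ (hstar x).1}).toReal)
    (fun h => {x | h x = hstar x}) (Real.exp_pos (-I₀)).le hinfo m
  rw [← Real.exp_nat_mul, mul_neg] at hbound
  exact ⟨hbound, fun hm => hbound.trans (mul_exp_neg_le_of_log_add_log_div_le
    (Nat.cast_pos.2 (Finset.card_pos.2 ⟨hstar, hmem⟩)) hδ.1 hI hm)⟩
end

section
/- (Product-structured classes have uninformative CoT.) Let F be a finite set of functions X → Y, G a set of functions X → Z, and let H := {x ↦ (f x, g x) : f ∈ F, g ∈ G} be the product CoT hypothesis class. Fix f* ∈ F, g* ∈ G and h* := (x ↦ (f* x, g* x)). Fix ε ∈ [0,1] such that the set {f ∈ F : D{x | f x ≠ f* x} > ε} is nonempty, and let ε⁺ := min{D{x | f x ≠ f* x} : f ∈ F, D{x | f x ≠ f* x} > ε}. Then the CoT information satisfies I_{D,h*}(ε;H) = −log(1 − ε⁺); in particular, it coincides with the end-to-end information and observing the chain-of-thought yields no statistical advantage. -/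
open MeasureTheory ENNReal

/-- Negative logarithm valued in `[0,∞]`, with `−log 0 = ∞`. -/
noncomputable def negLog (p : ℝ≥0∞) : ℝ≥0∞ :=
  if p = 0 then ⊤ else ENNReal.ofReal (-Real.log p.toReal)

/-- Relative CoT information `I_D(h₁,h₂) = −log D{x | h₁ x = h₂ x}`. -/
noncomputable def relCotInfo {X Y Z : Type*} [MeasurableSpace X]
    (D : Measure X) (h₁ h₂ : X → Y × Z) : ℝ≥0∞ :=
  negLog (D {x | h₁ x = h₂ x})

/-- `Δ_D(ε; H, hstar)`: hypotheses in `H` whose end-to-end risk exceeds `ε`. -/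
noncomputable def deltaSet {X Y Z : Type*} [MeasurableSpace X]
    (D : Measure X) (H : Set (X → Y × Z)) (hstar : X → Y × Z) (ε : ℝ) :
    Set (X → Y × Z) :=
  {h ∈ H | ε < e2eRisk D hstar h}

/-- CoT information `I_{D,hstar}(ε; H) = inf_{h ∈ Δ} I_D(hstar, h)` (in `[0,∞]`). -/
noncomputable def cotInfo {X Y Z : Type*} [MeasurableSpace X]
    (D : Measure X) (H : Set (X → Y × Z)) (hstar : X → Y × Z) (ε : ℝ) : ℝ≥0∞ :=
  ⨅ h ∈ deltaSet D H hstar ε, relCotInfo D hstar h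

theorem negLog_antitone_of_le_one {p q : ℝ≥0∞} (hpq : p ≤ q) (hq : q ≤ 1) :
    negLog q ≤ negLog p := by
  unfold negLog
  by_cases hp : p = 0
  · simp [hp]
  have hq0 : q ≠ 0 := fun h => hp (le_antisymm (h ▸ hpq) bot_le)
  have hqt : q ≠ ⊤ := ne_top_of_le_ne_top one_ne_top hq
  rw [if_neg hp, if_neg hq0]
  refine ofReal_le_ofReal (neg_le_neg (Real.log_le_log ?_ (toReal_mono hqt hpq)))
  exact toReal_pos hp (ne_top_of_le_ne_top hqt hpq)

theorem measure_agree_eq_ofReal_one_sub {X Y : Type*} [Finite X] [MeasurableSpace X]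
    [MeasurableSingletonClass X] (D : Measure X) [IsProbabilityMeasure D] (f g : X → Y) :
    D {x | g x = f x} = ENNReal.ofReal (1 - (D {x | f x ≠ g x}).toReal) := by
  have hc : {x | g x = f x} = {x | f x ≠ g x}ᶜ := by
    ext x
    simp [eq_comm]
  rw [hc, prob_compl_eq_one_sub (Set.toFinite _).measurableSet,
    ofReal_sub _ toReal_nonneg, ofReal_one, ofReal_toReal (measure_ne_top _ _)]

theorem product_class_uninformative_cot
    {X Y Z : Type*} [Fintype X] [Nonempty X] [Fintype Y] [Nonempty Y]
    [Fintype Z] [Nonempty Z] [MeasurableSpace X] [MeasurableSingletonClass X]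
    (D : Measure X) [IsProbabilityMeasure D]
    (F : Finset (X → Y)) (G : Set (X → Z))
    (fstar : X → Y) (hf : fstar ∈ F) (gstar : X → Z) (hg : gstar ∈ G)
    (ε : ℝ) (hε0 : 0 ≤ ε) (hε1 : ε ≤ 1)
    (hne : ∃ f ∈ F, ε < (D {x | f x ≠ fstar x}).toReal) :
    cotInfo D
        {h : X → Y × Z | ∃ f ∈ F, ∃ g ∈ G, h = fun x => (f x, g x)}
        (fun x => (fstar x, gstar x)) ε
      = negLog (ENNReal.ofReal
          (1 - sInf {r : ℝ | ∃ f ∈ F,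
            (D {x | f x ≠ fstar x}).toReal = r ∧ ε < r})) := by
  set S : Set ℝ := {r : ℝ | ∃ f ∈ F, (D {x | f x ≠ fstar x}).toReal = r ∧ ε < r}
  have hfin : S.Finite := by
    refine (F.finite_toSet.image fun f => (D {x | f x ≠ fstar x}).toReal).subset ?_
    rintro r ⟨f, hfF, hr, -⟩
    exact ⟨f, hfF, hr⟩
  have hSne : S.Nonempty := by
    obtain ⟨f, hfF, hlt⟩ := hne
    exact ⟨_, f, hfF, rfl, hlt⟩
  apply le_antisymm
  · obtain ⟨f, hfF, hr, hlt⟩ := hSne.csInf_mem hfin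
    have hmem : (fun x => (f x, gstar x)) ∈ deltaSet D
        {h : X → Y × Z | ∃ f ∈ F, ∃ g ∈ G, h = fun x => (f x, g x)}
        (fun x => (fstar x, gstar x)) ε :=
      ⟨⟨f, hfF, gstar, hg, rfl⟩, hlt.trans_eq hr.symm⟩
    refine (iInf₂_le _ hmem).trans_eq ?_
    rw [← hr, ← measure_agree_eq_ofReal_one_sub]
    simp [relCotInfo]
  · refine le_iInf₂ ?_
    rintro _ ⟨⟨f, hfF, g, -, rfl⟩, hlt⟩
    have hle : sInf S ≤ (D {x | f x ≠ fstar x}).toReal :=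
      csInf_le hfin.bddBelow ⟨f, hfF, rfl, hlt⟩
    refine negLog_antitone_of_le_one ?_ ?_
    · calc D {x | (fstar x, gstar x) = (f x, g x)}
          ≤ D {x | fstar x = f x} := measure_mono fun x hx => congrArg Prod.fst hx
        _ = ENNReal.ofReal (1 - (D {x | f x ≠ fstar x}).toReal) :=
          measure_agree_eq_ofReal_one_sub D f fstar
        _ ≤ ENNReal.ofReal (1 - sInf S) := ofReal_le_ofReal (by linarith)
    · obtain ⟨_, -, -, hpos⟩ := hSne.csInf_mem hfin
      exact ofReal_le_one.2 (by linarith)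
end

section
/- (CoT consisting of T i.i.d. function evaluations multiplies the information by T.) Let X̄ and Ȳ be nonempty finite types, D̄ a probability measure on X̄, T ≥ 1, and X := Fin T → X̄ with D := D̄^⊗T. For a function f : X̄ → Ȳ define the CoT hypothesis h_f : X → (Fin T → Ȳ) × Ȳ by h_f(x) := ((t ↦ f(x t)), f(x (T−1))). Then for any f, f* : X̄ → Ȳ: D{x | h_f x = h_{f*} x} = (D̄{u | f u = f* u})^T, and if D̄{u | f u ≠ f* u} > ε then D{x | h_f x = h_{f*} x} ≤ (1 − ε)^T ≤ exp(−T·ε). Consequently, for the class H := {h_f : f ∈ F} (F any finite set of functions X̄ → Ȳ containing f*) and h* := h_{f*}, the CoT information satisfies I_{D,h*}(ε;H) ≥ T·ε. -/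
open MeasureTheory ENNReal

/-- The CoT hypothesis whose chain-of-thought consists of `T` i.i.d. evaluations of
`f`, with end-to-end output `f (x (T−1))` (output in the first component and
chain-of-thought in the second component). -/
noncomputable def iidCoT {Xb Yb : Type*} (T : ℕ) (hT : 1 ≤ T) (f : Xb → Yb) :
    (Fin T → Xb) → Yb × (Fin T → Yb) :=
  fun x => (f (x ⟨T - 1, by omega⟩), fun t => f (x t))

/-- Two iterated hypotheses agree on a sequence iff they agree on every coordinate. -/
lemma setOf_iidCoT_eq {Xb Yb : Type*} (T : ℕ) (hT : 1 ≤ T) (f g : Xb → Yb) :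
    {x | iidCoT T hT f x = iidCoT T hT g x} = Set.univ.pi fun _ : Fin T => {u | f u = g u} := by
  ext x
  simp only [iidCoT, Set.mem_ofPred_eq, Prod.mk.injEq, funext_iff, Set.mem_pi, Set.mem_univ,
    true_implies]
  exact ⟨fun h => h.2, fun h => ⟨h _, h⟩⟩

/-- The agreement probability of two iterated hypotheses is a power. -/
lemma pi_iidCoT_eq {Xb Yb : Type*} [MeasurableSpace Xb] (Db : Measure Xb) [SigmaFinite Db]
    (T : ℕ) (hT : 1 ≤ T) (f g : Xb → Yb) :
    (Measure.pi fun _ : Fin T => Db) {x | iidCoT T hT f x = iidCoT T hT g x}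
      = (Db {u | f u = g u}) ^ T := by
  rw [setOf_iidCoT_eq, Measure.pi_pi]
  simp

/-- If `f` and `g` disagree with probability more than `ε`, then `T` independent evaluations
agree with probability at most `(1 - ε) ^ T`. -/
lemma pi_iidCoT_eq_toReal_le {Xb Yb : Type*} [Finite Xb] [MeasurableSpace Xb]
    [MeasurableSingletonClass Xb] (Db : Measure Xb) [IsProbabilityMeasure Db]
    (T : ℕ) (hT : 1 ≤ T) (f g : Xb → Yb) {ε : ℝ}
    (h : ε < (Db {u | f u ≠ g u}).toReal) :
    ((Measure.pi fun _ : Fin T => Db)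
      {x | iidCoT T hT f x = iidCoT T hT g x}).toReal ≤ (1 - ε) ^ T := by
  rw [pi_iidCoT_eq, ENNReal.toReal_pow]
  have hc : Db.real {u | f u = g u}ᶜ = 1 - Db.real {u | f u = g u} :=
    probReal_compl_eq_one_sub (Set.toFinite _).measurableSet
  have hlt : ε < Db.real {u | f u = g u}ᶜ := h
  refine pow_le_pow_left₀ ENNReal.toReal_nonneg ?_ T
  change Db.real {u | f u = g u} ≤ 1 - ε
  linarith

lemma one_sub_pow_le_exp_neg_mul {ε : ℝ} (hε : ε ≤ 1) (T : ℕ) :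
    (1 - ε) ^ T ≤ Real.exp (-((T : ℝ) * ε)) := by
  rw [← mul_neg, Real.exp_nat_mul]
  exact pow_le_pow_left₀ (sub_nonneg.2 hε) (Real.one_sub_le_exp_neg ε) T

lemma ofReal_le_negLog {p : ℝ≥0∞} (hp : p ≠ ∞) {a : ℝ} (h : p.toReal ≤ Real.exp (-a)) :
    ENNReal.ofReal a ≤ negLog p := by
  unfold negLog
  split_ifs with h0
  · exact le_top
  · have := (Real.log_le_iff_le_exp (ENNReal.toReal_pos h0 hp)).2 h
    exact ENNReal.ofReal_le_ofReal (by linarith)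

/-- The end-to-end risk only depends on the last coordinate. -/
lemma e2eRisk_iidCoT {Xb Yb : Type*} [Finite Xb] [MeasurableSpace Xb]
    [MeasurableSingletonClass Xb] (Db : Measure Xb) [IsProbabilityMeasure Db]
    (T : ℕ) (hT : 1 ≤ T) (f g : Xb → Yb) :
    e2eRisk (Measure.pi fun _ : Fin T => Db) (iidCoT T hT f) (iidCoT T hT g)
      = (Db {u | g u ≠ f u}).toReal := by
  have := (measurePreserving_eval (fun _ : Fin T => Db) ⟨T - 1, by omega⟩).measure_preimage
    (Set.toFinite {u | g u ≠ f u}).measurableSet.nullMeasurableSet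
  exact congrArg ENNReal.toReal this

theorem iid_cot_multiplies_information
    {Xb Yb : Type*} [Fintype Xb] [Nonempty Xb] [Fintype Yb] [Nonempty Yb]
    [MeasurableSpace Xb] [MeasurableSingletonClass Xb]
    (Db : Measure Xb) [IsProbabilityMeasure Db]
    (T : ℕ) (hT : 1 ≤ T)
    (f fstar : Xb → Yb)
    (F : Finset (Xb → Yb)) (hfstar : fstar ∈ F)
    (ε : ℝ) (hε0 : 0 ≤ ε) (hε1 : ε ≤ 1) :
    (Measure.pi fun _ : Fin T => Db)
        {x | iidCoT T hT f x = iidCoT T hT fstar x}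
      = (Db {u | f u = fstar u}) ^ T
    ∧ (ε < (Db {u | f u ≠ fstar u}).toReal →
        ((Measure.pi fun _ : Fin T => Db)
            {x | iidCoT T hT f x = iidCoT T hT fstar x}).toReal ≤ (1 - ε) ^ T
        ∧ (1 - ε) ^ T ≤ Real.exp (-((T : ℝ) * ε)))
    ∧ ENNReal.ofReal ((T : ℝ) * ε)
        ≤ cotInfo (Measure.pi fun _ : Fin T => Db)
            {h | ∃ g ∈ F, h = iidCoT T hT g} (iidCoT T hT fstar) ε := by
  refine ⟨pi_iidCoT_eq Db T hT f fstar, fun h => ⟨pi_iidCoT_eq_toReal_le Db T hT f fstar h,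
    one_sub_pow_le_exp_neg_mul hε1 T⟩, ?_⟩
  refine le_iInf₂ ?_
  rintro _ ⟨⟨g, -, rfl⟩, hg⟩
  rw [e2eRisk_iidCoT] at hg
  refine ofReal_le_negLog (measure_ne_top _ _) ?_
  simp only [ne_comm (a := g _)] at hg
  exact (pi_iidCoT_eq_toReal_le Db T hT fstar g hg).trans (one_sub_pow_le_exp_neg_mul hε1 T)
end

section
/- (State-trajectory CoT distinguishes finite automata.) Let Σ and S be nonempty finite types, s₀ ∈ S an initial state, and n ≥ 1. For a transition function δ : S → Σ → S and an input string x : Fin n → Σ, define the state trajectory traj(δ, x) : Fin n → S by s₋ := s₀ and traj(δ,x)(t) := δ(traj(δ,x)(t−1), x t) (i.e., the sequence of states visited when reading x from s₀). Let D be the uniform probability measure on Fin n → Σ. Suppose δ, δ* : S → Σ → S, and suppose there exist ℓ' with ℓ' + 1 ≤ n, a word w : Fin ℓ' → Σ, and a symbol a ∈ Σ such that, letting s be the state reached by δ* from s₀ after reading w, one has δ(s, a) ≠ δ*(s, a). Then D{x | traj(δ, x) = traj(δ*, x)} ≤ 1 − |Σ|^{−(ℓ'+1)}. -/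
open MeasureTheory ENNReal

/-- The state trajectory of the automaton with transition function `δ` and initial
state `s₀` on input `x`: `traj δ s₀ x t` is the state visited after reading the
symbols `x 0, …, x t`. -/
def traj {S A : Type*} (δ : S → A → S) (s₀ : S) {n : ℕ}
    (x : Fin n → A) (t : Fin n) : S :=
  ((List.ofFn x).take ((t : ℕ) + 1)).foldl δ s₀

/-- The uniform probability measure on a finite type. -/
noncomputable def unifMeasure (W : Type*) [Fintype W] [MeasurableSpace W] :
    Measure W :=
  (Fintype.card W : ℝ≥0∞)⁻¹ • Measure.count

theorem traj_eq_foldl_of_append {S A : Type*} (δ : S → A → S) (s₀ : S) {n : ℕ}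
    (x : Fin n → A) (u v : List A) (hx : List.ofFn x = u ++ v) (t : Fin n)
    (ht : (t : ℕ) + 1 = u.length) :
    traj δ s₀ x t = u.foldl δ s₀ := by
  rw [traj, hx, ht, List.take_left]

/-- Two automata whose transitions differ at the state the second one reaches after `w`
have different trajectories on every input that begins with `w` followed by `a`. -/
theorem traj_ne_of_prefix {S A : Type*} (δ δ' : S → A → S) (s₀ : S) {n : ℕ}
    (x : Fin n → A) (w : List A) (a : A) (v : List A)
    (hx : List.ofFn x = w ++ a :: v)
    (hdiff : δ (w.foldl δ' s₀) a ≠ δ' (w.foldl δ' s₀) a) :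
    traj δ s₀ x ≠ traj δ' s₀ x := by
  intro h
  have hn : n = w.length + (v.length + 1) := by
    simpa using congrArg List.length hx
  have hw : w.foldl δ s₀ = w.foldl δ' s₀ := by
    rcases Nat.eq_zero_or_pos w.length with h0 | hpos
    · simp [List.length_eq_zero_iff.mp h0]
    · have ht := congrFun h ⟨w.length - 1, by omega⟩
      have hlen : w.length - 1 + 1 = w.length := by omega
      rwa [traj_eq_foldl_of_append δ s₀ x w _ hx _ hlen,
        traj_eq_foldl_of_append δ' s₀ x w _ hx _ hlen] at ht
  have hx' : List.ofFn x = (w ++ [a]) ++ v := by simpa using hx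
  have ht := congrFun h ⟨w.length, by omega⟩
  rw [traj_eq_foldl_of_append δ s₀ x _ _ hx' _ (by simp),
    traj_eq_foldl_of_append δ' s₀ x _ _ hx' _ (by simp)] at ht
  simp only [List.foldl_append, List.foldl_cons, List.foldl_nil, hw] at ht
  exact hdiff ht

theorem toReal_unifMeasure {W : Type*} [Fintype W] [MeasurableSpace W]
    [MeasurableSingletonClass W] (E : Set W) :
    (unifMeasure W E).toReal = (Fintype.card W : ℝ)⁻¹ * E.ncard := by
  rw [unifMeasure, Measure.smul_apply, Measure.count_apply_finite E E.toFinite,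
    smul_eq_mul, ENNReal.toReal_mul, ENNReal.toReal_inv, ENNReal.toReal_natCast,
    ENNReal.toReal_natCast, Set.ncard_eq_toFinset_card E E.toFinite]

/-- A set of strings that avoids every string with prefix `u` misses at least
`|A| ^ m` strings, where `m` is the number of free positions. -/
theorem ncard_add_le_of_forall_append_notMem {A : Type*} [Fintype A] {k m : ℕ}
    (u : Fin k → A) (E : Set (Fin (k + m) → A))
    (hE : ∀ y : Fin m → A, Fin.append u y ∉ E) :
    E.ncard + Fintype.card A ^ m ≤ Fintype.card A ^ (k + m) := by
  have hinj : Function.Injective (fun y : Fin m → A => Fin.append u y) :=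
    fun y z hyz => funext fun i => by simpa using congrFun hyz (Fin.natAdd k i)
  have hdisj : Disjoint E (Set.range fun y : Fin m → A => Fin.append u y) := by
    rw [Set.disjoint_right]
    rintro _ ⟨y, rfl⟩
    exact hE y
  have hrange : (Set.range fun y : Fin m → A => Fin.append u y).ncard
      = Fintype.card A ^ m := by
    rw [← Set.image_univ, Set.ncard_image_of_injective _ hinj, Set.ncard_univ]
    simp
  rw [← hrange, ← Set.ncard_union_eq hdisj E.toFinite (Set.toFinite _)]
  calc _ ≤ (Set.univ : Set (Fin (k + m) → A)).ncard :=
        Set.ncard_le_ncard (Set.subset_univ _) Set.finite_univ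
    _ = _ := by rw [Set.ncard_univ]; simp

theorem state_trajectory_cot_distinguishes_automata
    {A S : Type*} [Fintype A] [Nonempty A] [Fintype S] [Nonempty S]
    [MeasurableSpace A] [MeasurableSingletonClass A]
    (s₀ : S) (n : ℕ) (hn : 1 ≤ n)
    (δ δstar : S → A → S)
    (ℓ' : ℕ) (hℓ : ℓ' + 1 ≤ n) (w : Fin ℓ' → A) (a : A)
    (hdiff : δ ((List.ofFn w).foldl δstar s₀) a
      ≠ δstar ((List.ofFn w).foldl δstar s₀) a) :
    ((unifMeasure (Fin n → A))
        {x | traj δ s₀ x = traj δstar s₀ x}).toReal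
      ≤ 1 - ((Fintype.card A : ℝ) ^ (ℓ' + 1))⁻¹ := by
  obtain ⟨m, rfl⟩ := Nat.exists_eq_add_of_le hℓ
  have hcount := ncard_add_le_of_forall_append_notMem (m := m)
    (Fin.snoc w a : Fin (ℓ' + 1) → A)
    {x | traj δ s₀ x = traj δstar s₀ x} fun y =>
      traj_ne_of_prefix δ δstar s₀ _ (List.ofFn w) a (List.ofFn y)
        (by rw [List.ofFn_fin_append, List.ofFn_succ']; simp) hdiff
  have hA : (0 : ℝ) < Fintype.card A := by exact_mod_cast Fintype.card_pos
  have hcount' : (({x : Fin (ℓ' + 1 + m) → A |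
      traj δ s₀ x = traj δstar s₀ x}.ncard : ℕ) : ℝ) + (Fintype.card A : ℝ) ^ m
        ≤ (Fintype.card A : ℝ) ^ (ℓ' + 1 + m) := by exact_mod_cast hcount
  have hcard : (Fintype.card (Fin (ℓ' + 1 + m) → A) : ℝ)
      = (Fintype.card A : ℝ) ^ (ℓ' + 1 + m) := by simp
  rw [toReal_unifMeasure, hcard, inv_mul_le_iff₀ (by positivity)]
  have hpow : (Fintype.card A : ℝ) ^ (ℓ' + 1 + m) * ((Fintype.card A : ℝ) ^ (ℓ' + 1))⁻¹
      = (Fintype.card A : ℝ) ^ m := by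
    rw [pow_add _ (ℓ' + 1) m]
    field_simp
  linarith
end

section
/- (Mixture KL bound used in the Fano argument.) Let Θ be a nonempty finite type, π a probability measure on Θ, and for each θ ∈ Θ let P_θ be a probability measure on a nonempty finite type Ω. Let P̄ := ∑_{θ} π{θ}·P_θ be the mixture measure, and for m ≥ 1 let μ^⊗m denote the m-fold product of a measure μ on Fin m → Ω. Then ∑_{θ} π{θ}·KL(P_θ^⊗m ‖ P̄^⊗m) ≤ m · ∑_{θ₁, θ₂} π{θ₁}·π{θ₂}·KL(P_{θ₁} ‖ P_{θ₂}) (all quantities in [0,∞]). -/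
open MeasureTheory ENNReal

/-- If `μ` is absolutely continuous with respect to `ν`, the divergence is the real sum. -/
lemma finKL_of_ac {W : Type*} [Fintype W] [MeasurableSpace W] {μ ν : Measure W}
    (h : ∀ w : W, ν {w} = 0 → μ {w} = 0) :
    finKL μ ν = ENNReal.ofReal
      (∑ w : W, (μ {w}).toReal * Real.log ((μ {w}).toReal / (ν {w}).toReal)) :=
  if_pos h

lemma finKL_of_not_ac {W : Type*} [Fintype W] [MeasurableSpace W] {μ ν : Measure W}
    (h : ¬ ∀ w : W, ν {w} = 0 → μ {w} = 0) : finKL μ ν = ⊤ :=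
  if_neg h

lemma sum_measureReal_singleton_eq_one {W : Type*} [Fintype W] [MeasurableSpace W]
    [MeasurableSingletonClass W] (μ : Measure W) [IsProbabilityMeasure μ] :
    ∑ w : W, (μ {w}).toReal = 1 := by
  rw [← ENNReal.toReal_sum (fun w _ => measure_ne_top μ {w}), sum_measure_singleton]
  simp

/-- Under a product weight `∏ j, p (x j)` with `∑ w, p w = 1`, the expectation of a function of
the `i`-th coordinate is the expectation under `p`. -/
lemma sum_prod_mul_apply {ι W : Type*} [Fintype ι] [DecidableEq ι] [Fintype W] {p : W → ℝ}
    (hp : ∑ w, p w = 1) (l : W → ℝ) (i : ι) :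
    ∑ x : ι → W, (∏ j, p (x j)) * l (x i) = ∑ w, p w * l w := by
  have h : ∀ x : ι → W,
      (∏ j, p (x j)) * l (x i) = ∏ j, p (x j) * (if j = i then l (x j) else 1) := by
    intro x
    rw [Finset.prod_mul_distrib, Finset.prod_ite_eq' Finset.univ i (fun j => l (x j))]
    simp
  simp_rw [h]
  rw [← Fintype.prod_sum (fun j w => p w * (if j = i then l w else 1)),
    Finset.prod_eq_single i]
  · simp
  · intro j _ hj
    simp [hj, hp]
  · simp

lemma sum_prod_mul_log_prod_div_prod {ι W : Type*} [Fintype ι] [DecidableEq ι] [Fintype W] {p q : W → ℝ}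
    (hp : ∑ w, p w = 1) (hpq : ∀ w, q w = 0 → p w = 0) :
    ∑ x : ι → W, (∏ j, p (x j)) * Real.log ((∏ j, p (x j)) / ∏ j, q (x j))
      = Fintype.card ι * ∑ w, p w * Real.log (p w / q w) := by
  have h : ∀ x : ι → W, (∏ j, p (x j)) * Real.log ((∏ j, p (x j)) / ∏ j, q (x j))
      = ∑ i, (∏ j, p (x j)) * Real.log (p (x i) / q (x i)) := by
    intro x
    by_cases hx : ∏ j, p (x j) = 0
    · simp [hx]
    · have hx' : ∀ j, p (x j) ≠ 0 := fun j => Finset.prod_ne_zero_iff.mp hx j (Finset.mem_univ j)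
      rw [← Finset.prod_div_distrib, Real.log_prod, Finset.mul_sum]
      exact fun j _ => div_ne_zero (hx' j) (fun h0 => hx' j (hpq _ h0))
  simp_rw [h]
  rw [Finset.sum_comm]
  simp_rw [fun i => sum_prod_mul_apply hp (fun w => Real.log (p w / q w)) i]
  simp

/-- The divergence is at most additive over independent copies. -/
lemma finKL_pi_le {ι W : Type*} [Fintype ι] [DecidableEq ι] [Fintype W] [MeasurableSpace W]
    [MeasurableSingletonClass W] (μ ν : Measure W) [IsProbabilityMeasure μ]
    [IsFiniteMeasure ν] (hμν : ∀ w : W, ν {w} = 0 → μ {w} = 0) :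
    finKL (Measure.pi fun _ : ι => μ) (Measure.pi fun _ : ι => ν)
      ≤ (Fintype.card ι : ℝ≥0∞) * finKL μ ν := by
  have hac : ∀ x : ι → W, (Measure.pi fun _ : ι => ν) {x} = 0 →
      (Measure.pi fun _ : ι => μ) {x} = 0 := by
    intro x hx
    rw [Measure.pi_singleton, Finset.prod_eq_zero_iff] at hx ⊢
    obtain ⟨i, hi, h⟩ := hx
    exact ⟨i, hi, hμν _ h⟩
  rw [finKL_of_ac hac, finKL_of_ac hμν, ← ENNReal.ofReal_natCast,
    ← ENNReal.ofReal_mul (Nat.cast_nonneg _)]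
  simp_rw [Measure.pi_singleton, ENNReal.toReal_prod]
  rw [← sum_prod_mul_log_prod_div_prod (sum_measureReal_singleton_eq_one μ)
    (q := fun w => (ν {w}).toReal)]
  intro w hw
  rw [hμν w (((ENNReal.toReal_eq_zero_iff _).mp hw).resolve_right (measure_ne_top ν _))]
  rfl

/-- Convexity of `q ↦ p * log (p / q)` in the form of Jensen's inequality. -/
lemma mul_log_div_sum_le {T : Type*} [Fintype T] {c q : T → ℝ} {p : ℝ}
    (hc : ∀ t, 0 ≤ c t) (hc1 : ∑ t, c t = 1) (hp : 0 ≤ p)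
    (hq : ∀ t, c t ≠ 0 → p ≠ 0 → 0 < q t) :
    p * Real.log (p / ∑ t, c t * q t) ≤ ∑ t, c t * (p * Real.log (p / q t)) := by
  classical
  rcases hp.eq_or_lt with rfl | hp
  · simp
  let s : Finset T := Finset.univ.filter (fun t => c t ≠ 0)
  have restrict : ∀ f : T → ℝ, ∑ t ∈ s, c t * f t = ∑ t, c t * f t := by
    intro f
    refine Finset.sum_subset (Finset.subset_univ _) fun t _ ht => ?_
    have : c t = 0 := by simpa [s] using ht
    simp [this]
  have hs1 : ∑ t ∈ s, c t = 1 := by simpa [hc1] using restrict 1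
  have hqs : ∀ t ∈ s, 0 < q t := fun t ht => hq t (Finset.mem_filter.mp ht).2 hp.ne'
  have hcs : ∀ t ∈ s, 0 < c t := fun t ht =>
    lt_of_le_of_ne (hc t) (Finset.mem_filter.mp ht).2.symm
  have hne : s.Nonempty := by
    by_contra h
    simp [Finset.not_nonempty_iff_eq_empty.mp h] at hs1
  have hpos : 0 < ∑ t ∈ s, c t * q t :=
    Finset.sum_pos (fun t ht => mul_pos (hcs t ht) (hqs t ht)) hne
  have hJ := strictConcaveOn_log_Ioi.concaveOn.le_map_sum (t := s) (w := c) (p := q)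
    (fun t _ => hc t) hs1 hqs
  simp only [smul_eq_mul] at hJ
  rw [← restrict q, ← restrict, Real.log_div hp.ne' hpos.ne']
  have hR : ∑ t ∈ s, c t * (p * Real.log (p / q t))
      = p * (Real.log p - ∑ t ∈ s, c t * Real.log (q t)) := by
    rw [mul_sub, Finset.mul_sum, ← one_mul (p * Real.log p), ← hs1, Finset.sum_mul,
      ← Finset.sum_sub_distrib]
    refine Finset.sum_congr rfl fun t ht => ?_
    rw [Real.log_div hp.ne' (hqs t ht).ne']
    ring
  rw [hR]
  gcongr

/-- Convexity of the divergence in its second argument. -/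
lemma finKL_sum_smul_le {T W : Type*} [Fintype T] [Fintype W] [MeasurableSpace W]
    {c : T → ℝ≥0∞} (hc : ∑ t, c t = 1) (μ : Measure W) (Q : T → Measure W)
    [∀ t, IsFiniteMeasure (Q t)] [IsFiniteMeasure μ] :
    finKL μ (∑ t, c t • Q t) ≤ ∑ t, c t * finKL μ (Q t) := by
  have hct : ∀ t, c t ≠ ⊤ := fun t h => by
    have := Finset.single_le_sum (f := c) (fun _ _ => zero_le) (Finset.mem_univ t)
    rw [hc, h] at this
    simp at this
  by_cases H : ∀ t, c t ≠ 0 → ∀ w : W, Q t {w} = 0 → μ {w} = 0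
  swap
  · push Not at H
    obtain ⟨t, ht, w, hw, hμw⟩ := H
    have htop : c t * finKL μ (Q t) = ⊤ := by
      rw [finKL_of_not_ac (fun h => hμw (h w hw)), ENNReal.mul_top ht]
    exact le_top.trans (htop ▸ Finset.single_le_sum (f := fun t => c t * finKL μ (Q t))
      (fun _ _ => zero_le) (Finset.mem_univ t))
  have happ : ∀ w : W, (∑ t, c t • Q t) {w} = ∑ t, c t * Q t {w} := by
    intro w
    simp [Measure.finsetSum_apply]
  have hne : ∃ t, c t ≠ 0 := by
    by_contra! h
    simp [h] at hc
  have hac : ∀ w : W, (∑ t, c t • Q t) {w} = 0 → μ {w} = 0 := by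
    intro w hw
    rw [happ, Finset.sum_eq_zero_iff] at hw
    obtain ⟨t, ht⟩ := hne
    exact H t ht w ((mul_eq_zero.mp (hw t (Finset.mem_univ t))).resolve_left ht)
  have hc1 : ∑ t, (c t).toReal = 1 := by
    rw [← ENNReal.toReal_sum (fun t _ => hct t), hc, ENNReal.toReal_one]
  have hterm : ∀ t, c t * finKL μ (Q t) = ENNReal.ofReal ((c t).toReal *
      ∑ w : W, (μ {w}).toReal * Real.log ((μ {w}).toReal / (Q t {w}).toReal)) := by
    intro t
    by_cases ht : c t = 0
    · simp [ht]
    · rw [finKL_of_ac (H t ht), ENNReal.ofReal_mul ENNReal.toReal_nonneg,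
        ENNReal.ofReal_toReal (hct t)]
  simp_rw [hterm]
  rw [finKL_of_ac hac]
  refine le_trans (ENNReal.ofReal_le_ofReal ?_)
    (Finset.le_sum_of_subadditive ENNReal.ofReal ENNReal.ofReal_zero.le
      (fun _ _ => ENNReal.ofReal_add_le) _ _)
  simp_rw [Finset.mul_sum]
  rw [Finset.sum_comm]
  refine Finset.sum_le_sum fun w _ => ?_
  have hw : ((∑ t, c t • Q t) {w}).toReal = ∑ t, (c t).toReal * (Q t {w}).toReal := by
    rw [happ, ENNReal.toReal_sum
      (fun t _ => ENNReal.mul_ne_top (hct t) (measure_ne_top _ _))]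
    simp_rw [ENNReal.toReal_mul]
  rw [hw]
  refine mul_log_div_sum_le (fun _ => ENNReal.toReal_nonneg) hc1 ENNReal.toReal_nonneg ?_
  intro t ht hμ
  refine ENNReal.toReal_pos (fun h0 => hμ ?_) (measure_ne_top _ _)
  rw [H t (fun h => ht (by simp [h])) w h0, ENNReal.toReal_zero]

theorem mixture_kl_bound_for_fano
    {Θ Ω : Type*} [Fintype Θ] [Nonempty Θ] [Fintype Ω] [Nonempty Ω]
    [MeasurableSpace Θ] [MeasurableSingletonClass Θ]
    [MeasurableSpace Ω] [MeasurableSingletonClass Ω]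
    (π : Measure Θ) [IsProbabilityMeasure π]
    (P : Θ → Measure Ω) (hP : ∀ θ, IsProbabilityMeasure (P θ))
    (m : ℕ) (hm : 1 ≤ m) :
    ∑ θ : Θ, π {θ}
        * finKL (Measure.pi fun _ : Fin m => P θ)
            (Measure.pi fun _ : Fin m => ∑ θ' : Θ, π {θ'} • P θ')
      ≤ (m : ℝ≥0∞) * ∑ θ₁ : Θ, ∑ θ₂ : Θ,
          π {θ₁} * π {θ₂} * finKL (P θ₁) (P θ₂) := by
  have hπ : ∑ θ : Θ, π {θ} = 1 := by
    rw [sum_measure_singleton]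
    simp
  have hfin : IsFiniteMeasure (∑ θ' : Θ, π {θ'} • P θ') := by
    refine ⟨?_⟩
    simp [Measure.finsetSum_apply, hπ]
  rw [Finset.mul_sum]
  refine Finset.sum_le_sum fun θ _ => ?_
  by_cases hθ : π {θ} = 0
  · simp [hθ]
  have hac : ∀ w : Ω, (∑ θ' : Θ, π {θ'} • P θ') {w} = 0 → P θ {w} = 0 := by
    intro w hw
    simp only [Measure.finsetSum_apply, Measure.smul_apply, smul_eq_mul,
      Finset.sum_eq_zero_iff] at hw
    exact (mul_eq_zero.mp (hw θ (Finset.mem_univ θ))).resolve_left hθ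
  calc π {θ} * finKL (Measure.pi fun _ : Fin m => P θ)
            (Measure.pi fun _ : Fin m => ∑ θ' : Θ, π {θ'} • P θ')
      ≤ π {θ} * (m * ∑ θ₂ : Θ, π {θ₂} * finKL (P θ) (P θ₂)) := by
        gcongr
        refine (finKL_pi_le _ _ hac).trans ?_
        rw [Fintype.card_fin]
        gcongr
        exact finKL_sum_smul_le hπ (P θ) P
    _ = m * ∑ θ₂ : Θ, π {θ} * π {θ₂} * finKL (P θ) (P θ₂) := by
        simp_rw [mul_assoc, ← Finset.mul_sum]
        exact mul_left_comm _ _ _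
end
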